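/- For every τ in the upper half-plane ℍ, F₃(τ + 1/2) = −F₃(τ) + (9/4)·F₃(2τ) − (1/4)·F₃(4τ). -/

import Mathlib

open scoped Real

/-- `F₃(τ) = Σ_{m≥1} Σ_{n≥1} e^{2πimnτ}/n³`. -/
noncomputable def F₃ (τ : ℂ) : ℂ :=
  ∑' m : ℕ, ∑' n : ℕ,
    Complex.exp (2 * Real.pi * Complex.I * ((m : ℂ) + 1) * ((n : ℂ) + 1) * τ) / ((n : ℂ) + 1) ^ 3

/-- The general term of the double series defining `F₃`. -/
noncomputable def F₃Term (τ : ℂ) (m n : ℕ) : ℂ :=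
  Complex.exp (2 * Real.pi * Complex.I * ((m : ℂ) + 1) * ((n : ℂ) + 1) * τ) / ((n : ℂ) + 1) ^ 3

theorem F₃_eq_tsum_F₃Term (τ : ℂ) : F₃ τ = ∑' m : ℕ, ∑' n : ℕ, F₃Term τ m n := rfl

theorem norm_F₃Term_le {τ : ℂ} (hτ : 0 < τ.im) (m n : ℕ) :
    ‖F₃Term τ m n‖ ≤ Real.exp (-(2 * π * τ.im)) ^ m * Real.exp (-(2 * π * τ.im)) ^ n := by
  have hden : (1 : ℝ) ≤ ‖((n : ℂ) + 1) ^ 3‖ := by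
    have : ‖(n : ℂ) + 1‖ = (n : ℝ) + 1 := by
      exact_mod_cast Complex.norm_natCast (n + 1)
    rw [norm_pow, this]
    exact one_le_pow₀ (by linarith [n.cast_nonneg (α := ℝ)])
  rw [F₃Term, norm_div]
  refine (div_le_self (norm_nonneg _) hden).trans ?_
  have hre : (2 * Real.pi * Complex.I * ((m : ℂ) + 1) * ((n : ℂ) + 1) * τ).re
      = -(2 * π * τ.im) * (((m : ℝ) + 1) * ((n : ℝ) + 1)) := by
    have : 2 * Real.pi * Complex.I * ((m : ℂ) + 1) * ((n : ℂ) + 1) * τ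
        = ((2 * π * ((m + 1) * (n + 1)) : ℝ) : ℂ) * (Complex.I * τ) := by
      push_cast; ring
    rw [this, Complex.re_ofReal_mul, Complex.I_mul_re]
    ring
  rw [Complex.norm_exp, hre, ← Real.exp_nat_mul, ← Real.exp_nat_mul, ← Real.exp_add,
    Real.exp_le_exp]
  have hc : 0 < 2 * π * τ.im := by positivity
  have hmn : (0 : ℝ) ≤ m * n := by positivity
  nlinarith

theorem exp_neg_two_pi_mul_lt_one {y : ℝ} (hy : 0 < y) : Real.exp (-(2 * π * y)) < 1 := by
  rw [Real.exp_lt_one_iff]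
  have : 0 < 2 * π * y := by positivity
  linarith

theorem summable_F₃Term {τ : ℂ} (hτ : 0 < τ.im) (m : ℕ) : Summable (F₃Term τ m) :=
  .of_norm_bounded ((summable_geometric_of_lt_one (Real.exp_pos _).le
    (exp_neg_two_pi_mul_lt_one hτ)).mul_left _) (norm_F₃Term_le hτ m)

theorem summable_tsum_F₃Term {τ : ℂ} (hτ : 0 < τ.im) :
    Summable fun m ↦ ∑' n, F₃Term τ m n := by
  have hg := summable_geometric_of_lt_one (Real.exp_pos (-(2 * π * τ.im))).le
    (exp_neg_two_pi_mul_lt_one hτ)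
  exact .of_norm_bounded (hg.mul_right _) fun m ↦
    (tsum_of_norm_bounded (hg.hasSum.mul_left _) (norm_F₃Term_le hτ m))

theorem F₃Term_odd_left (τ : ℂ) (k n : ℕ) : F₃Term τ (2 * k + 1) n = F₃Term (2 * τ) k n := by
  unfold F₃Term
  congr 2
  push_cast
  ring

theorem F₃Term_odd_right (τ : ℂ) (m j : ℕ) :
    F₃Term τ m (2 * j + 1) = 1 / 8 * F₃Term (2 * τ) m j := by
  have hj : (j : ℂ) + 1 ≠ 0 := Nat.cast_add_one_ne_zero j
  have hden : ((2 * j + 1 : ℕ) : ℂ) + 1 = 2 * ((j : ℂ) + 1) := by push_cast; ring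
  unfold F₃Term
  rw [hden, show 2 * Real.pi * Complex.I * ((m : ℂ) + 1) * (2 * ((j : ℂ) + 1)) * τ
    = 2 * Real.pi * Complex.I * ((m : ℂ) + 1) * ((j : ℂ) + 1) * (2 * τ) by ring]
  field_simp
  norm_num

theorem F₃Term_add_half (τ : ℂ) (m n : ℕ) :
    F₃Term (τ + 1 / 2) m n = (-1) ^ ((m + 1) * (n + 1)) * F₃Term τ m n := by
  have : 2 * Real.pi * Complex.I * ((m : ℂ) + 1) * ((n : ℂ) + 1) * (τ + 1 / 2)
      = (((m + 1) * (n + 1) : ℕ) : ℂ) * (Real.pi * Complex.I)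
        + 2 * Real.pi * Complex.I * ((m : ℂ) + 1) * ((n : ℂ) + 1) * τ := by
    push_cast; ring
  rw [F₃Term, this, Complex.exp_add, Complex.exp_nat_mul, Complex.exp_pi_mul_I, F₃Term,
    mul_div_assoc]

theorem tsum_F₃Term_add_half_odd (τ : ℂ) (k : ℕ) :
    ∑' n, F₃Term (τ + 1 / 2) (2 * k + 1) n = ∑' n, F₃Term (2 * τ) k n := by
  refine tsum_congr fun n ↦ ?_
  rw [F₃Term_add_half, F₃Term_odd_left, Even.neg_one_pow, one_mul]
  exact Even.mul_right ⟨k + 1, by ring⟩ _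

theorem tsum_F₃Term_even_right {τ : ℂ} (hτ : 0 < τ.im) (m : ℕ) :
    ∑' j, F₃Term τ m (2 * j) = ∑' n, F₃Term τ m n - 1 / 8 * ∑' n, F₃Term (2 * τ) m n := by
  have hs := summable_F₃Term hτ m
  rw [← tsum_even_add_odd (hs.comp_injective (mul_right_injective₀ two_ne_zero))
    (hs.comp_injective ((add_left_injective 1).comp (mul_right_injective₀ two_ne_zero)))]
  simp_rw [F₃Term_odd_right, tsum_mul_left]
  ring

theorem tsum_F₃Term_add_half_even {τ : ℂ} (hτ : 0 < τ.im) (k : ℕ) :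
    ∑' n, F₃Term (τ + 1 / 2) (2 * k) n
      = -∑' n, F₃Term τ (2 * k) n + 1 / 4 * ∑' n, F₃Term (2 * τ) (2 * k) n := by
  have hs := summable_F₃Term (τ := τ + 1 / 2) (by simpa using hτ) (2 * k)
  rw [← tsum_even_add_odd (hs.comp_injective (mul_right_injective₀ two_ne_zero))
    (hs.comp_injective ((add_left_injective 1).comp (mul_right_injective₀ two_ne_zero)))]
  have heven (j : ℕ) : F₃Term (τ + 1 / 2) (2 * k) (2 * j) = -F₃Term τ (2 * k) (2 * j) := by
    rw [F₃Term_add_half, Odd.neg_one_pow, neg_one_mul]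
    exact Odd.mul ⟨k, rfl⟩ ⟨j, rfl⟩
  have hodd (j : ℕ) :
      F₃Term (τ + 1 / 2) (2 * k) (2 * j + 1) = 1 / 8 * F₃Term (2 * τ) (2 * k) j := by
    rw [F₃Term_add_half, F₃Term_odd_right, Even.neg_one_pow, one_mul]
    exact Even.mul_left ⟨j + 1, by ring⟩ _
  simp_rw [heven, hodd, tsum_neg, tsum_mul_left, tsum_F₃Term_even_right hτ]
  ring

theorem summable_tsum_F₃Term_even {τ : ℂ} (hτ : 0 < τ.im) :
    Summable fun k ↦ ∑' n, F₃Term τ (2 * k) n :=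
  (summable_tsum_F₃Term hτ).comp_injective (mul_right_injective₀ two_ne_zero)

theorem F₃_eq_even_add_odd {τ : ℂ} (hτ : 0 < τ.im) :
    F₃ τ = ∑' k, ∑' n, F₃Term τ (2 * k) n + ∑' k, ∑' n, F₃Term τ (2 * k + 1) n := by
  have hodd : Summable fun k ↦ ∑' n, F₃Term τ (2 * k + 1) n :=
    (summable_tsum_F₃Term hτ).comp_injective (i := fun k ↦ 2 * k + 1)
      ((add_left_injective 1).comp (mul_right_injective₀ two_ne_zero))
  rw [F₃_eq_tsum_F₃Term]
  exact (tsum_even_add_odd (f := fun m ↦ ∑' n, F₃Term τ m n)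
    (summable_tsum_F₃Term_even hτ) hodd).symm

theorem tsum_F₃Term_even_left {τ : ℂ} (hτ : 0 < τ.im) :
    ∑' k, ∑' n, F₃Term τ (2 * k) n = F₃ τ - F₃ (2 * τ) := by
  rw [F₃_eq_even_add_odd hτ, F₃_eq_tsum_F₃Term (2 * τ)]
  simp_rw [F₃Term_odd_left]
  ring

theorem F₃_half_translation (τ : ℂ) (hτ : 0 < τ.im) :
    F₃ (τ + 1 / 2) = -F₃ τ + 9 / 4 * F₃ (2 * τ) - 1 / 4 * F₃ (4 * τ) := by
  have hτ₂ : 0 < (2 * τ).im := by simpa using hτ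
  rw [F₃_eq_even_add_odd (by simpa using hτ)]
  simp_rw [tsum_F₃Term_add_half_odd, tsum_F₃Term_add_half_even hτ]
  rw [(summable_tsum_F₃Term_even hτ).neg.tsum_add
    ((summable_tsum_F₃Term_even hτ₂).mul_left _), tsum_neg, tsum_mul_left,
    tsum_F₃Term_even_left hτ, tsum_F₃Term_even_left hτ₂, ← F₃_eq_tsum_F₃Term,
    show 2 * (2 * τ) = 4 * τ by ring]
  ring
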